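/- arXiv:1709.08472 — 3 statements merged into one kernel-verified Lean document; each statement's English description precedes it below -/
import Mathlib

section
/- Let E be a real Banach space, T > 0, and let S be a strongly continuous semigroup on E with M := sup_{t∈[0,T]} ‖S(t)‖_{L(E)} < ∞ satisfying the analyticity-type estimate. Let p > 1, α ∈ (1/p, 1) and δ ∈ [0, α − 1/p). Then there exists a constant C = C(T, p, α, δ, M) such that for every f ∈ L^p(0,T;E) the function R_α f is well defined on [0,T], satisfies (R_α f)(0) = 0, and is δ-Hölder continuous: ‖(R_α f)(t₂) − (R_α f)(t₁)‖ ≤ C ‖f‖_{L^p(0,T;E)} |t₂ − t₁|^δ for all t₁, t₂ ∈ [0,T]. In particular R_α is a bounded linear operator from L^p(0,T;E) to C^δ([0,T];E). -/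
open MeasureTheory Set Real

lemma hold_aux {E : Type*} [NormedAddCommGroup E] [NormedSpace ℝ E]
    (T : ℝ) (p β : ℝ) (hp : 1 < p) (hβ : 1 / p - 1 < β)
    (f : ℝ → E) (hf : AEStronglyMeasurable f (volume.restrict (Ioc (0 : ℝ) T)))
    (hfp : IntegrableOn (fun r => ‖f r‖ ^ p) (Ioc (0 : ℝ) T))
    (t : ℝ) (ht : t ∈ Icc (0 : ℝ) T) :
    IntegrableOn (fun r => (t - r) ^ β * ‖f r‖) (Ioc (0 : ℝ) t) ∧
    ∫ r in Ioc (0 : ℝ) t, (t - r) ^ β * ‖f r‖ ≤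
      (∫ u in Ioc (0 : ℝ) T, u ^ (β * (p / (p - 1)))) ^ (1 / (p / (p - 1))) *
      (∫ r in Ioc (0 : ℝ) T, ‖f r‖ ^ p) ^ (1 / p) := by
  have hp0 : 0 < p := by linarith
  set q := p / (p - 1) with hq
  have hpq : p.HolderConjugate q := Real.HolderConjugate.conjExponent hp
  have hq0 : 0 < q := hpq.symm.pos
  have hsub : Ioc (0 : ℝ) t ⊆ Ioc 0 T := Ioc_subset_Ioc_right ht.2
  have hexp : -1 < β * q := by
    have h1 : 1 / p + 1 / q = 1 := by simpa using hpq.inv_add_inv_eq_one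
    have h2 : -(1 / q) < β := by linarith
    have h3 := mul_lt_mul_of_pos_right h2 hq0
    have h4 : -(1 / q) * q = -1 := by field_simp
    linarith
  have hII : ∀ s, IntervalIntegrable (fun u : ℝ => u ^ (β * q)) volume 0 s := fun s =>
    intervalIntegral.intervalIntegrable_rpow' hexp
  have hI : IntegrableOn (fun r => (t - r) ^ (β * q)) (Ioc 0 t) := by
    have := (hII t).comp_sub_left t
    simp only [sub_zero, sub_self] at this
    exact (intervalIntegrable_iff_integrableOn_Ioc_of_le ht.1).1 this.symm
  have hpow : ∀ r ∈ Ioc (0 : ℝ) t, ((t - r) ^ β) ^ q = (t - r) ^ (β * q) := fun r hr =>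
    (Real.rpow_mul (by linarith [hr.2]) _ _).symm
  have hm1 : AEStronglyMeasurable (fun r => (t - r) ^ β) (volume.restrict (Ioc 0 t)) :=
    ((measurable_const.sub measurable_id).pow_const β).aestronglyMeasurable
  have hL1 : MemLp (fun r => (t - r) ^ β) (ENNReal.ofReal q) (volume.restrict (Ioc 0 t)) := by
    rw [← integrable_norm_rpow_iff hm1 (by simpa using hq0) ENNReal.ofReal_ne_top,
      ENNReal.toReal_ofReal hq0.le]
    refine hI.congr ?_
    filter_upwards [ae_restrict_mem measurableSet_Ioc] with r hr
    rw [← hpow r hr, Real.norm_of_nonneg]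
    exact Real.rpow_nonneg (by linarith [hr.2]) _
  have hfm : AEStronglyMeasurable f (volume.restrict (Ioc 0 t)) := hf.mono_set hsub
  have hL2 : MemLp (fun r => ‖f r‖) (ENNReal.ofReal p) (volume.restrict (Ioc 0 t)) := by
    rw [← integrable_norm_rpow_iff hfm.norm (by simpa using hp0) ENNReal.ofReal_ne_top,
      ENNReal.toReal_ofReal hp0.le]
    simp only [norm_norm]
    exact hfp.mono_set hsub
  have : ENNReal.HolderConjugate (ENNReal.ofReal q) (ENNReal.ofReal p) := hpq.symm.ennrealOfReal
  refine ⟨hL1.integrable_mul hL2, ?_⟩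
  refine (integral_mul_le_Lp_mul_Lq_of_nonneg hpq.symm ?_ ?_ hL1 hL2).trans ?_
  · filter_upwards [ae_restrict_mem measurableSet_Ioc] with r hr
    exact Real.rpow_nonneg (by linarith [hr.2]) _
  · exact Filter.Eventually.of_forall fun r => norm_nonneg _
  have e1 : ∫ r in Ioc 0 t, ((t - r) ^ β) ^ q = ∫ u in Ioc 0 t, u ^ (β * q) := by
    rw [setIntegral_congr_fun measurableSet_Ioc hpow,
      ← intervalIntegral.integral_of_le ht.1, ← intervalIntegral.integral_of_le ht.1]
    simpa using intervalIntegral.integral_comp_sub_left (fun u : ℝ => u ^ (β * q)) t (a := 0) (b := t)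
  rw [e1]
  have n1 : ∀ s : ℝ, (0 : ℝ) ≤ ∫ u in Ioc (0 : ℝ) s, u ^ (β * q) := fun s =>
    setIntegral_nonneg measurableSet_Ioc fun u hu => Real.rpow_nonneg hu.1.le _
  have n2 : ∀ s : ℝ, (0 : ℝ) ≤ ∫ u in Ioc 0 s, ‖f u‖ ^ p := fun s =>
    setIntegral_nonneg measurableSet_Ioc fun u hu => Real.rpow_nonneg (norm_nonneg _) _
  have hTI : IntegrableOn (fun u : ℝ => u ^ (β * q)) (Ioc 0 T) :=
    (intervalIntegrable_iff_integrableOn_Ioc_of_le (ht.1.trans ht.2)).1 (hII T)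
  refine mul_le_mul ?_ ?_ (Real.rpow_nonneg (n2 _) _) (Real.rpow_nonneg (n1 _) _)
  · refine Real.rpow_le_rpow (n1 _) (setIntegral_mono_set hTI ?_ hsub.eventuallyLE) (by positivity)
    filter_upwards [ae_restrict_mem measurableSet_Ioc] with r hr
    exact Real.rpow_nonneg hr.1.le _
  · refine Real.rpow_le_rpow (n2 _) (setIntegral_mono_set hfp ?_ hsub.eventuallyLE) (by positivity)
    exact Filter.Eventually.of_forall fun r => Real.rpow_nonneg (norm_nonneg _) _

lemma meas_aux {E : Type*} [NormedAddCommGroup E] [NormedSpace ℝ E]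
    (S : ℝ → E →L[ℝ] E) (hScont : ∀ x : E, Continuous fun t : ℝ => S t x)
    (f : ℝ → E) (s : Set ℝ) (hf : AEStronglyMeasurable f (volume.restrict s)) (t γ : ℝ) :
    AEStronglyMeasurable (fun r => (t - r) ^ γ • S (t - r) (f r)) (volume.restrict s) := by
  have hm1 : AEStronglyMeasurable (fun r => (t - r) ^ γ) (volume.restrict s) :=
    ((measurable_const.sub measurable_id).pow_const γ).aestronglyMeasurable
  refine hm1.smul ?_
  obtain ⟨g, hg, hfg⟩ := hf
  have h := stronglyMeasurable_uncurry_of_continuous_of_stronglyMeasurable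
    (u := fun (a : ℝ) (r : ℝ) => S a (g r)) (fun r => hScont (g r))
    (fun a => (S a).continuous.comp_stronglyMeasurable hg)
  have h2 : StronglyMeasurable (fun r : ℝ => S (t - r) (g r)) :=
    h.comp_measurable (g := fun r : ℝ => (t - r, r))
      ((measurable_const.sub measurable_id).prodMk measurable_id)
  refine ⟨_, h2, ?_⟩
  filter_upwards [hfg] with r hr
  rw [hr]

lemma pow_aux (α δ u h : ℝ) (hα0 : 0 < α) (hα1 : α < 1) (hδ0 : 0 ≤ δ) (hδ1 : δ ≤ 1)
    (hu : 0 < u) (hh : 0 < h) :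
    |(u + h) ^ (α - 1) - u ^ (α - 1)| ≤ h ^ δ * u ^ (α - 1 - δ) := by
  have h1 : (u + h) ^ (α - 1) ≤ u ^ (α - 1) :=
    Real.rpow_le_rpow_of_nonpos hu (by linarith) (by linarith)
  rw [abs_sub_comm, abs_of_nonneg (by linarith)]
  have hx : 0 < h / u := by positivity
  have e1 : h ^ δ * u ^ (α - 1 - δ) = u ^ (α - 1) * (h / u) ^ δ := by
    rw [Real.rpow_sub hu, Real.div_rpow hh.le hu.le]; ring
  have e2 : (u + h) ^ (α - 1) = u ^ (α - 1) * (1 + h / u) ^ (α - 1) := by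
    rw [← Real.mul_rpow hu.le (by positivity)]; congr 1; field_simp
  rw [e1, e2]
  have key : 1 - (1 + h / u) ^ (α - 1) ≤ (h / u) ^ δ := by
    set x := h / u
    rcases le_or_gt 1 x with h1x | h1x
    · have a := Real.one_le_rpow h1x hδ0
      have b : 0 ≤ (1 + x) ^ (α - 1) := by positivity
      linarith
    · have a : (1 + x) ^ (-1 : ℝ) ≤ (1 + x) ^ (α - 1) :=
        Real.rpow_le_rpow_of_exponent_le (by linarith) (by linarith)
      rw [Real.rpow_neg_one] at a
      have b : x ≤ x ^ δ := by
        simpa using Real.rpow_le_rpow_of_exponent_ge hx h1x.le hδ1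
      have c : 1 - x ≤ (1 + x)⁻¹ := by
        rw [← one_div, le_div_iff₀ (by linarith)]; nlinarith
      linarith
  have := mul_le_mul_of_nonneg_left key (Real.rpow_nonneg hu.le (α - 1))
  linarith

/-- Hölder regularity of the factorization operator
`(R_α f)(t) = ∫₀ᵗ (t-r)^(α-1) S(t-r) f(r) dr` on `L^p(0,T;E)` for an analytic
semigroup `S` on a Banach space `E`. -/
theorem stmt_0
    {E : Type*} [NormedAddCommGroup E] [NormedSpace ℝ E] [CompleteSpace E]
    (T : ℝ) (hT : 0 < T)
    (S : ℝ → E →L[ℝ] E)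
    (hS0 : S 0 = ContinuousLinearMap.id ℝ E)
    (hSadd : ∀ s t : ℝ, 0 ≤ s → 0 ≤ t → S (t + s) = (S t).comp (S s))
    (hScont : ∀ x : E, Continuous fun t : ℝ => S t x)
    (M : ℝ) (hM : ∀ t ∈ Icc (0 : ℝ) T, ‖S t‖ ≤ M)
    (hana : ∀ ρ ∈ Icc (0 : ℝ) 1, ∃ Cρ : ℝ, 0 ≤ Cρ ∧
      ∀ t ∈ Ioc (0 : ℝ) T, ∀ h ∈ Ioc (0 : ℝ) T,
        ‖(S h).comp (S t) - S t‖ ≤ Cρ * h ^ ρ * t ^ (-ρ))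
    (p α δ : ℝ) (hp : 1 < p) (hα : α ∈ Ioo (1 / p) 1)
    (hδ : δ ∈ Ico (0 : ℝ) (α - 1 / p)) :
    ∃ C : ℝ, 0 ≤ C ∧
      ∀ f : ℝ → E,
        AEStronglyMeasurable f (volume.restrict (Ioc (0 : ℝ) T)) →
        IntegrableOn (fun r => ‖f r‖ ^ p) (Ioc (0 : ℝ) T) →
        -- `R_α f` is well defined on `[0,T]`
        (∀ t ∈ Icc (0 : ℝ) T,
          IntegrableOn (fun r => (t - r) ^ (α - 1) • S (t - r) (f r)) (Ioc (0 : ℝ) t)) ∧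
        -- `(R_α f)(0) = 0`
        (∫ r in Ioc (0 : ℝ) (0 : ℝ), ((0 : ℝ) - r) ^ (α - 1) • S (0 - r) (f r)) = 0 ∧
        -- `R_α f` is `δ`-Hölder continuous with constant `C ‖f‖_{L^p(0,T;E)}`
        ∀ t₁ ∈ Icc (0 : ℝ) T, ∀ t₂ ∈ Icc (0 : ℝ) T,
          ‖(∫ r in Ioc (0 : ℝ) t₂, (t₂ - r) ^ (α - 1) • S (t₂ - r) (f r)) -
              ∫ r in Ioc (0 : ℝ) t₁, (t₁ - r) ^ (α - 1) • S (t₁ - r) (f r)‖ ≤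
            C * (∫ r in Ioc (0 : ℝ) T, ‖f r‖ ^ p) ^ (1 / p) * |t₂ - t₁| ^ δ := by
  have hp0 : 0 < p := by linarith
  have hip : 0 < 1 / p := by positivity
  obtain ⟨hα1, hα2⟩ := hα
  obtain ⟨hδ0, hδ1⟩ := hδ
  have hα0 : 0 < α := by linarith
  have hδ2 : δ ≤ 1 := by linarith
  have hM0 : 0 ≤ M := (norm_nonneg _).trans (hM 0 ⟨le_rfl, hT.le⟩)
  obtain ⟨K, hK0, hK⟩ := hana δ ⟨hδ0, hδ2⟩
  set A := (∫ u in Ioc (0 : ℝ) T, u ^ ((α - 1 - δ) * (p / (p - 1)))) ^ (1 / (p / (p - 1))) with hA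
  have hA0 : 0 ≤ A := Real.rpow_nonneg
    (setIntegral_nonneg measurableSet_Ioc fun u hu => Real.rpow_nonneg hu.1.le _) _
  refine ⟨(M + (K + M)) * A, by positivity, fun f hf hfp => ?_⟩
  have hint : ∀ t ∈ Icc (0 : ℝ) T,
      IntegrableOn (fun r => (t - r) ^ (α - 1) • S (t - r) (f r)) (Ioc (0 : ℝ) t) := by
    intro t ht
    have h1 := (hold_aux T p (α - 1) hp (by linarith) f hf hfp t ht).1
    refine Integrable.mono' (h1.const_mul M)
      (meas_aux S hScont f _ (hf.mono_set (Ioc_subset_Ioc_right ht.2)) t _) ?_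
    filter_upwards [ae_restrict_mem measurableSet_Ioc] with r hr
    have hn : 0 ≤ (t - r) ^ (α - 1) := Real.rpow_nonneg (by linarith [hr.2]) _
    rw [norm_smul, Real.norm_of_nonneg hn]
    have := (S (t - r)).le_of_opNorm_le
      (hM (t - r) ⟨by linarith [hr.2], by linarith [hr.1, ht.2]⟩) (f r)
    calc _ ≤ (t - r) ^ (α - 1) * (M * ‖f r‖) := mul_le_mul_of_nonneg_left this hn
      _ = _ := by ring
  set N := (∫ r in Ioc (0 : ℝ) T, ‖f r‖ ^ p) ^ (1 / p) with hN
  have hN0 : 0 ≤ N := Real.rpow_nonneg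
    (setIntegral_nonneg measurableSet_Ioc fun u hu => Real.rpow_nonneg (norm_nonneg _) _) _
  have main : ∀ t₁ ∈ Icc (0 : ℝ) T, ∀ t₂ ∈ Icc (0 : ℝ) T, t₁ < t₂ →
      ‖(∫ r in Ioc (0 : ℝ) t₂, (t₂ - r) ^ (α - 1) • S (t₂ - r) (f r)) -
              ∫ r in Ioc (0 : ℝ) t₁, (t₁ - r) ^ (α - 1) • S (t₁ - r) (f r)‖ ≤
            (M + (K + M)) * A * N * (t₂ - t₁) ^ δ := by
    intro t₁ ht₁ t₂ ht₂ hlt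
    have hh : 0 < t₂ - t₁ := by linarith
    set h := t₂ - t₁ with hhdef
    have hhδ : 0 ≤ h ^ δ := by positivity
    obtain ⟨hi1, hb1⟩ := hold_aux T p (α - 1 - δ) hp (by linarith) f hf hfp t₁ ht₁
    obtain ⟨hi2, hb2⟩ := hold_aux T p (α - 1 - δ) hp (by linarith) f hf hfp t₂ ht₂
    have hs1 : Ioc 0 t₁ ⊆ Ioc 0 t₂ := Ioc_subset_Ioc_right hlt.le
    have hs2 : Ioc t₁ t₂ ⊆ Ioc 0 t₂ := Ioc_subset_Ioc_left ht₁.1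
    have hg2 := hint t₂ ht₂
    have hsplit : ∫ r in Ioc (0 : ℝ) t₂, (t₂ - r) ^ (α - 1) • S (t₂ - r) (f r) =
        (∫ r in Ioc (0 : ℝ) t₁, (t₂ - r) ^ (α - 1) • S (t₂ - r) (f r)) +
        ∫ r in Ioc t₁ t₂, (t₂ - r) ^ (α - 1) • S (t₂ - r) (f r) := by
      rw [← Ioc_union_Ioc_eq_Ioc ht₁.1 hlt.le]
      exact setIntegral_union (Ioc_disjoint_Ioc_of_le le_rfl) measurableSet_Ioc
        (hg2.mono_set hs1) (hg2.mono_set hs2)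
    have B1 : ‖∫ r in Ioc t₁ t₂, (t₂ - r) ^ (α - 1) • S (t₂ - r) (f r)‖ ≤
        h ^ δ * M * (A * N) := by
      have st1 : ‖∫ r in Ioc t₁ t₂, (t₂ - r) ^ (α - 1) • S (t₂ - r) (f r)‖ ≤
          ∫ r in Ioc t₁ t₂, h ^ δ * M * ((t₂ - r) ^ (α - 1 - δ) * ‖f r‖) := by
        refine norm_integral_le_of_norm_le ((hi2.mono_set hs2).const_mul _) ?_
        filter_upwards [ae_restrict_mem measurableSet_Ioc,
          ae_restrict_of_ae (Measure.ae_ne volume t₂)] with r hr hne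
        have hpos : 0 < t₂ - r := sub_pos.2 (lt_of_le_of_ne hr.2 hne)
        have hn : 0 ≤ (t₂ - r) ^ (α - 1) := by positivity
        rw [norm_smul, Real.norm_of_nonneg hn]
        have h1 := (S (t₂ - r)).le_of_opNorm_le
          (hM (t₂ - r) ⟨hpos.le, by linarith [hr.1, ht₂.2, ht₁.1]⟩) (f r)
        have h2 : (t₂ - r) ^ (α - 1) ≤ h ^ δ * (t₂ - r) ^ (α - 1 - δ) := by
          have e : (t₂ - r) ^ (α - 1) = (t₂ - r) ^ δ * (t₂ - r) ^ (α - 1 - δ) := by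
            rw [← Real.rpow_add hpos]; congr 1; ring
          rw [e]
          refine mul_le_mul_of_nonneg_right ?_ (by positivity)
          exact Real.rpow_le_rpow hpos.le (by linarith [hr.1]) hδ0
        calc _ ≤ (h ^ δ * (t₂ - r) ^ (α - 1 - δ)) * (M * ‖f r‖) :=
              mul_le_mul h2 h1 (norm_nonneg _) (by positivity)
          _ = _ := by ring
      refine st1.trans ?_
      rw [integral_const_mul]
      refine mul_le_mul_of_nonneg_left (le_trans ?_ hb2) (by positivity)
      refine setIntegral_mono_set hi2 ?_ hs2.eventuallyLE
      filter_upwards [ae_restrict_mem measurableSet_Ioc] with r hr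
      exact mul_nonneg (Real.rpow_nonneg (by linarith [hr.2]) _) (norm_nonneg _)
    have B2 : ‖(∫ r in Ioc (0 : ℝ) t₁, (t₂ - r) ^ (α - 1) • S (t₂ - r) (f r)) -
        ∫ r in Ioc (0 : ℝ) t₁, (t₁ - r) ^ (α - 1) • S (t₁ - r) (f r)‖ ≤
        h ^ δ * (K + M) * (A * N) := by
      rw [← integral_sub (hg2.mono_set hs1) (hint t₁ ht₁)]
      refine le_trans (norm_integral_le_of_norm_le
        (g := fun r => h ^ δ * (K + M) * ((t₁ - r) ^ (α - 1 - δ) * ‖f r‖))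
        (hi1.const_mul _) ?_) ?_
      · filter_upwards [ae_restrict_mem measurableSet_Ioc,
          ae_restrict_of_ae (Measure.ae_ne volume t₁)] with r hr hne
        have hu : 0 < t₁ - r := sub_pos.2 (lt_of_le_of_ne hr.2 hne)
        have e2 : t₂ - r = (t₁ - r) + h := by rw [hhdef]; ring
        rw [e2]
        have huT : t₁ - r ≤ T := by linarith [hr.1, ht₁.2]
        set u := t₁ - r with hudef
        have hS2 : S (u + h) = (S h).comp (S u) := by
          rw [add_comm]; exact hSadd u h hu.le hh.le
        have h1 := ((S h).comp (S u) - S u).le_of_opNorm_le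
          (hK u ⟨hu, huT⟩ h ⟨hh, by linarith [ht₂.2, ht₁.1]⟩) (f r)
        have h2 := (S u).le_of_opNorm_le (hM u ⟨hu.le, huT⟩) (f r)
        have h3 := pow_aux α δ u h hα0 hα2 hδ0 hδ2 hu hh
        have h4 : (u + h) ^ (α - 1) ≤ u ^ (α - 1) :=
          Real.rpow_le_rpow_of_nonpos hu (by linarith) (by linarith)
        have dec : (u + h) ^ (α - 1) • S (u + h) (f r) - u ^ (α - 1) • S u (f r) =
            (u + h) ^ (α - 1) • (((S h).comp (S u) - S u) (f r)) +
            ((u + h) ^ (α - 1) - u ^ (α - 1)) • S u (f r) := by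
          rw [hS2, ContinuousLinearMap.sub_apply, smul_sub, sub_smul]; abel
        rw [dec]
        refine (norm_add_le _ _).trans ?_
        rw [norm_smul, norm_smul, Real.norm_eq_abs, Real.norm_eq_abs,
          abs_of_nonneg (by positivity : 0 ≤ (u + h) ^ (α - 1))]
        have e3 : u ^ (α - 1) * u ^ (-δ) = u ^ (α - 1 - δ) := by
          rw [← Real.rpow_add hu]; congr 1
        have i1 := mul_le_mul h4 h1 (norm_nonneg _) (by positivity)
        have i2 := mul_le_mul h3 h2 (norm_nonneg _) (by positivity)
        calc _ ≤ _ := add_le_add i1 i2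
          _ = h ^ δ * K * (u ^ (α - 1) * u ^ (-δ)) * ‖f r‖ +
              h ^ δ * M * u ^ (α - 1 - δ) * ‖f r‖ := by ring
          _ = _ := by rw [e3]; ring
      · rw [integral_const_mul]
        exact mul_le_mul_of_nonneg_left hb1 (by positivity)
    rw [hsplit, add_sub_right_comm]
    refine (norm_add_le _ _).trans ((add_le_add B2 B1).trans (le_of_eq ?_))
    ring
  refine ⟨hint, by simp, fun t₁ ht₁ t₂ ht₂ => ?_⟩
  rcases lt_trichotomy t₁ t₂ with hlt | heq | hlt
  · rw [abs_of_pos (by linarith)]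
    exact main t₁ ht₁ t₂ ht₂ hlt
  · subst heq
    rw [sub_self, norm_zero]
    positivity
  · rw [norm_sub_rev, abs_sub_comm, abs_of_pos (by linarith)]
    exact main t₂ ht₂ t₁ ht₁ hlt
end

section
/- Let E and E₁ be real Banach spaces, T > 0, μ ∈ [0,1), and let W : (0,T] → L(E,E₁) be a strongly continuous family of bounded linear operators such that (i) there is C₀ with ‖W(t)‖_{L(E,E₁)} ≤ C₀ t^{−μ} for all t ∈ (0,T], and (ii) for every ρ ∈ (0,1] there is C_ρ with ‖W(t₂) − W(t₁)‖_{L(E,E₁)} ≤ C_ρ (t₂ − t₁)^ρ t₁^{−(μ+ρ)} for all 0 < t₁ ≤ t₂ ≤ T. Let p > 1 and α ∈ (μ + 1/p, 1), and set δ := α − 1/p − μ > 0. Then there exists a constant C such that for every f ∈ L^p(0,T;E) the function (R_α^W f)(t) := ∫₀ᵗ (t−r)^{α−1} W(t−r) f(r) dr is well defined on [0,T], vanishes at t = 0, and is δ-Hölder continuous with ‖(R_α^W f)(t₂) − (R_α^W f)(t₁)‖_{E₁} ≤ C ‖f‖_{L^p(0,T;E)} |t₂ − t₁|^δ for all t₁,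 t₂ ∈ [0,T]. -/
open MeasureTheory Set Real

lemma aux_holder {E E₁ : Type*} [NormedAddCommGroup E] [NormedAddCommGroup E₁] [NormedSpace ℝ E₁]
    {p q : ℝ} (hpq : p.HolderConjugate q) {A : Set ℝ} (hA : MeasurableSet A)
    {f : ℝ → E} (hf : AEStronglyMeasurable f (volume.restrict A))
    (hfp : IntegrableOn (fun r => ‖f r‖ ^ p) A)
    {g : ℝ → ℝ} (hg : Measurable g) (hg0 : ∀ r ∈ A, 0 ≤ g r)
    (hgq : IntegrableOn (fun r => g r ^ q) A)
    {F : ℝ → E₁} (hF : AEStronglyMeasurable F (volume.restrict A))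
    {c : ℝ} (hc : 0 ≤ c) (hb : ∀ r ∈ A, ‖F r‖ ≤ c * (g r * ‖f r‖)) :
    IntegrableOn F A ∧ ‖∫ r in A, F r‖ ≤
      c * ((∫ r in A, g r ^ q) ^ (1 / q) * (∫ r in A, ‖f r‖ ^ p) ^ (1 / p)) := by
  have hp0 : 0 < p := hpq.pos
  have hq0 : 0 < q := hpq.symm.pos
  have hgae : 0 ≤ᵐ[volume.restrict A] g := (ae_restrict_iff' hA).2 (ae_of_all _ hg0)
  have hfae : 0 ≤ᵐ[volume.restrict A] fun r => ‖f r‖ := ae_of_all _ fun r => norm_nonneg _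
  have mf : MemLp (fun r => ‖f r‖) (ENNReal.ofReal p) (volume.restrict A) := by
    rw [← integrable_norm_rpow_iff hf.norm (by simpa using hp0) ENNReal.ofReal_ne_top,
      ENNReal.toReal_ofReal hp0.le]
    simpa only [norm_norm] using (show Integrable _ (volume.restrict A) from hfp)
  have mg : MemLp g (ENNReal.ofReal q) (volume.restrict A) := by
    rw [← integrable_norm_rpow_iff hg.aestronglyMeasurable (by simpa using hq0)
      ENNReal.ofReal_ne_top, ENNReal.toReal_ofReal hq0.le]
    refine Integrable.congr hgq ?_
    filter_upwards [hgae] with r hr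
    rw [Real.norm_of_nonneg hr]
  have hint : Integrable (fun r => g r * ‖f r‖) (volume.restrict A) := by
    have : ENNReal.HolderConjugate (ENNReal.ofReal q) (ENNReal.ofReal p) :=
      hpq.symm.ennrealOfReal
    exact mg.integrable_mul mf
  have hbae : ∀ᵐ r ∂(volume.restrict A), ‖F r‖ ≤ c * (g r * ‖f r‖) :=
    (ae_restrict_iff' hA).2 (ae_of_all _ hb)
  refine ⟨Integrable.mono' (hint.const_mul c) hF hbae, ?_⟩
  refine (norm_integral_le_of_norm_le (hint.const_mul c) hbae).trans ?_
  rw [integral_const_mul]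
  exact mul_le_mul_of_nonneg_left
    (integral_mul_le_Lp_mul_Lq_of_nonneg hpq.symm hgae hfae mg mf) hc

lemma aux_ker1 {β q m t : ℝ} (hmt : m ≤ t) (hβ : 0 < β * q + 1) :
    IntegrableOn (fun r => ((t - r) ^ β) ^ q) (Ioc m t) ∧
    ∫ r in Ioc m t, ((t - r) ^ β) ^ q = (t - m) ^ (β * q + 1) / (β * q + 1) := by
  have heq : EqOn (fun r => (t - r) ^ (β * q)) (fun r => ((t - r) ^ β) ^ q) (Ioc m t) := by
    intro r hr
    exact Real.rpow_mul (by linarith [hr.2]) _ _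
  have h1 : IntervalIntegrable (fun x : ℝ => x ^ (β * q)) volume (t - t) (t - m) :=
    intervalIntegral.intervalIntegrable_rpow' (by linarith)
  have h2 : IntervalIntegrable (fun r : ℝ => (t - r) ^ (β * q)) volume m t := by
    simpa using (h1.comp_sub_left t).symm
  constructor
  · exact ((intervalIntegrable_iff_integrableOn_Ioc_of_le hmt).1 h2).congr_fun heq
      measurableSet_Ioc
  · rw [← setIntegral_congr_fun measurableSet_Ioc heq, ← intervalIntegral.integral_of_le hmt,
      intervalIntegral.integral_comp_sub_left (fun x : ℝ => x ^ (β * q)) t,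
      integral_rpow (Or.inl (by linarith))]
    simp [Real.zero_rpow hβ.ne']

lemma aux_ker2 {γ q m t h : ℝ} (hh : 0 < h) (hmt : m ≤ t - h) (hγ : γ * q + 1 < 0) :
    IntegrableOn (fun r => ((t - r) ^ γ) ^ q) (Ioc m (t - h)) ∧
    ∫ r in Ioc m (t - h), ((t - r) ^ γ) ^ q ≤ h ^ (γ * q + 1) / (-(γ * q + 1)) := by
  have heq : EqOn (fun r => (t - r) ^ (γ * q)) (fun r => ((t - r) ^ γ) ^ q) (Ioc m (t - h)) := by
    intro r hr
    exact Real.rpow_mul (by linarith [hr.2]) _ _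
  have hz : (0 : ℝ) ∉ uIcc h (t - m) := by
    rw [uIcc_of_le (by linarith)]
    intro hx
    linarith [hx.1]
  have h1 : IntervalIntegrable (fun x : ℝ => x ^ (γ * q)) volume h (t - m) :=
    intervalIntegral.intervalIntegrable_rpow (Or.inr hz)
  have h2 : IntervalIntegrable (fun r : ℝ => (t - r) ^ (γ * q)) volume m (t - h) := by
    simpa using (h1.comp_sub_left t).symm
  constructor
  · exact ((intervalIntegrable_iff_integrableOn_Ioc_of_le hmt).1 h2).congr_fun heq
      measurableSet_Ioc
  · rw [← setIntegral_congr_fun measurableSet_Ioc heq, ← intervalIntegral.integral_of_le hmt,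
      intervalIntegral.integral_comp_sub_left (fun x : ℝ => x ^ (γ * q)) t, sub_sub_cancel,
      integral_rpow (Or.inr ⟨by linarith, hz⟩), div_neg, ← neg_div]
    rw [div_le_div_right_of_neg hγ]
    have : 0 ≤ (t - m) ^ (γ * q + 1) := Real.rpow_nonneg (by linarith) _
    linarith

lemma aux_rpow {a s h : ℝ} (ha : 0 < a) (ha1 : a < 1) (hs : 0 < s) (hh : 0 ≤ h) :
    |(s + h) ^ (a - 1) - s ^ (a - 1)| ≤ h * s ^ (a - 2) := by
  have hsh : 0 < s + h := by linarith
  have h1 : (s + h) ^ (a - 1) ≤ s ^ (a - 1) :=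
    Real.rpow_le_rpow_of_nonpos hs (by linarith) (by linarith)
  rw [abs_sub_comm, abs_of_nonneg (by linarith)]
  have h2 : (s + h) ^ (a - 1) = s ^ (a - 1) * (s / (s + h)) ^ (1 - a) := by
    rw [Real.div_rpow hs.le hsh.le, mul_div_assoc', ← Real.rpow_add hs, sub_add_sub_cancel',
      sub_self, Real.rpow_zero, ← neg_sub a 1, Real.rpow_neg hsh.le, one_div, inv_inv]
  have h3 : s / (s + h) ≤ (s / (s + h)) ^ (1 - a) :=
    Real.self_le_rpow_of_le_one (by positivity) ((div_le_one hsh).2 (by linarith)) (by linarith)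
  have h4 : s ^ (a - 2) = s ^ (a - 1) / s := by
    rw [show a - 2 = (a - 1) - 1 by ring, Real.rpow_sub_one hs.ne']
  have h5 : 1 - s / (s + h) ≤ h / s := by
    rw [one_sub_div hsh.ne', add_sub_cancel_left]
    exact div_le_div_of_nonneg_left hh hs (by linarith)
  have h6 : 0 ≤ s ^ (a - 1) := Real.rpow_nonneg hs.le _
  rw [h2, h4]
  calc s ^ (a - 1) - s ^ (a - 1) * (s / (s + h)) ^ (1 - a)
      = s ^ (a - 1) * (1 - (s / (s + h)) ^ (1 - a)) := by ring
    _ ≤ s ^ (a - 1) * (h / s) := mul_le_mul_of_nonneg_left (by linarith) h6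
    _ = h * (s ^ (a - 1) / s) := by ring

lemma aux_cont {X : Type*} [NormedAddCommGroup X] {T μ C : ℝ} (hμ : 0 ≤ μ) (hC : 0 ≤ C)
    {W : ℝ → X} (hW : ∀ t₁ t₂ : ℝ, 0 < t₁ → t₁ ≤ t₂ → t₂ ≤ T →
        ‖W t₂ - W t₁‖ ≤ C * (t₂ - t₁) ^ (1 : ℝ) * t₁ ^ (-(μ + 1))) :
    ContinuousOn W (Ioc 0 T) := by
  intro x hx
  have hx0 : 0 < x := hx.1
  have hK : 0 ≤ C * (x / 2) ^ (-(μ + 1)) := by positivity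
  have key : ∀ a b : ℝ, x / 2 ≤ a → a ≤ b → b ≤ T →
      ‖W b - W a‖ ≤ C * (x / 2) ^ (-(μ + 1)) * (b - a) := by
    intro a b ha hab hb
    refine (hW a b (by linarith) hab hb).trans ?_
    have : a ^ (-(μ + 1)) ≤ (x / 2) ^ (-(μ + 1)) :=
      Real.rpow_le_rpow_of_nonpos (by linarith) ha (by linarith)
    rw [Real.rpow_one]
    calc C * (b - a) * a ^ (-(μ + 1)) ≤ C * (b - a) * (x / 2) ^ (-(μ + 1)) :=
          mul_le_mul_of_nonneg_left this (mul_nonneg hC (by linarith))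
      _ = _ := by ring
  have hl : LipschitzOnWith (Real.toNNReal (C * (x / 2) ^ (-(μ + 1)))) W (Icc (x / 2) T) := by
    refine LipschitzOnWith.of_dist_le_mul ?_
    intro a ha b hb
    rw [Real.coe_toNNReal _ hK]
    rcases le_total a b with hab | hab
    · rw [dist_comm, dist_eq_norm, dist_comm a b, Real.dist_eq, abs_of_nonneg (by linarith)]
      exact key a b ha.1 hab hb.2
    · rw [dist_eq_norm, Real.dist_eq, abs_of_nonneg (by linarith)]
      exact key b a hb.1 hab ha.2
  have hc := hl.continuousOn x ⟨by linarith, hx.2⟩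
  refine hc.mono_of_mem_nhdsWithin ?_
  filter_upwards [self_mem_nhdsWithin, mem_nhdsWithin_of_mem_nhds (Ioi_mem_nhds (half_lt_self hx0))]
    with y hy hy2
  exact ⟨le_of_lt hy2, hy.2⟩

/-- Abstract factorization lemma: for a strongly continuous family
`W : (0,T] → L(E,E₁)` with the smoothing bound `‖W(t)‖ ≤ C₀ t^(-μ)` and the
analyticity-type increment bound, and for `α ∈ (μ + 1/p, 1)`, the operator
`(R_α^W f)(t) = ∫₀ᵗ (t-r)^(α-1) W(t-r) f(r) dr` maps `L^p(0,T;E)` into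
`C^δ([0,T];E₁)` with `δ = α - 1/p - μ`. -/
theorem stmt_1
    {E E₁ : Type*} [NormedAddCommGroup E] [NormedSpace ℝ E]
    [NormedAddCommGroup E₁] [NormedSpace ℝ E₁] [CompleteSpace E₁]
    (T : ℝ) (hT : 0 < T) (μ : ℝ) (hμ : μ ∈ Ico (0 : ℝ) 1)
    (W : ℝ → E →L[ℝ] E₁)
    (hWcont : ∀ x : E, ContinuousOn (fun t : ℝ => W t x) (Ioc (0 : ℝ) T))
    (C₀ : ℝ) (hC₀ : ∀ t ∈ Ioc (0 : ℝ) T, ‖W t‖ ≤ C₀ * t ^ (-μ))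
    (hWinc : ∀ ρ ∈ Ioc (0 : ℝ) 1, ∃ Cρ : ℝ, 0 ≤ Cρ ∧
      ∀ t₁ t₂ : ℝ, 0 < t₁ → t₁ ≤ t₂ → t₂ ≤ T →
        ‖W t₂ - W t₁‖ ≤ Cρ * (t₂ - t₁) ^ ρ * t₁ ^ (-(μ + ρ)))
    (p α : ℝ) (hp : 1 < p) (hα : α ∈ Ioo (μ + 1 / p) 1) :
    ∃ C : ℝ, 0 ≤ C ∧
      ∀ f : ℝ → E,
        AEStronglyMeasurable f (volume.restrict (Ioc (0 : ℝ) T)) →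
        IntegrableOn (fun r => ‖f r‖ ^ p) (Ioc (0 : ℝ) T) →
        -- `R_α^W f` is well defined on `[0,T]`
        (∀ t ∈ Icc (0 : ℝ) T,
          IntegrableOn (fun r => (t - r) ^ (α - 1) • W (t - r) (f r)) (Ioc (0 : ℝ) t)) ∧
        -- it vanishes at `t = 0`
        (∫ r in Ioc (0 : ℝ) (0 : ℝ), ((0 : ℝ) - r) ^ (α - 1) • W (0 - r) (f r)) = 0 ∧
        -- and it is `(α - 1/p - μ)`-Hölder continuous
        ∀ t₁ ∈ Icc (0 : ℝ) T, ∀ t₂ ∈ Icc (0 : ℝ) T,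
          ‖(∫ r in Ioc (0 : ℝ) t₂, (t₂ - r) ^ (α - 1) • W (t₂ - r) (f r)) -
              ∫ r in Ioc (0 : ℝ) t₁, (t₁ - r) ^ (α - 1) • W (t₁ - r) (f r)‖ ≤
            C * (∫ r in Ioc (0 : ℝ) T, ‖f r‖ ^ p) ^ (1 / p) *
              |t₂ - t₁| ^ (α - 1 / p - μ) := by
  obtain ⟨C₁, hC₁, hW1⟩ := hWinc 1 ⟨one_pos, le_rfl⟩
  obtain ⟨hμ0, hμ1⟩ := hμ
  obtain ⟨hα0, hα1⟩ := hα
  have hC₀0 : 0 ≤ C₀ := by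
    have h := (norm_nonneg _).trans (hC₀ T ⟨hT, le_rfl⟩)
    exact nonneg_of_mul_nonneg_left h (Real.rpow_pos_of_pos hT _)
  have hWc : ContinuousOn W (Ioc 0 T) := aux_cont hμ0 hC₁ hW1
  obtain ⟨q, hpq⟩ : ∃ q, p.HolderConjugate q := ⟨_, Real.HolderConjugate.conjExponent hp⟩
  have hp0 : 0 < p := hpq.pos
  have hq0 : 0 < q := hpq.symm.pos
  have hpq1 : 1 / p + 1 / q = 1 := by
    simpa using hpq.inv_add_inv_eq_one
  have hip : 0 < 1 / p := by positivity
  have hiq : 1 / q * q = 1 := by field_simp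
  have hαpos : 0 < α := by linarith
  set δ : ℝ := α - 1 / p - μ with hδ
  have hδ0 : 0 < δ := by rw [hδ]; linarith
  set β : ℝ := α - 1 - μ with hβ
  have hβδ : β + 1 / q = δ := by rw [hβ, hδ]; linarith
  have hβq : β * q + 1 = δ * q := by rw [← hβδ]; linear_combination -hiq
  have hβq0 : 0 < β * q + 1 := by rw [hβq]; positivity
  have hγq : (β - 1) * q + 1 = (δ - 1) * q := by rw [← hβδ]; linear_combination -hiq
  have hγq0 : (β - 1) * q + 1 < 0 := by
    rw [hγq]; exact mul_neg_of_neg_of_pos (by rw [hδ]; linarith) hq0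
  have hβneg : β < 0 := by rw [hβ]; linarith
  -- kernel bounds
  have hK1 : ∀ s ∈ Icc (0 : ℝ) T, ∀ x : E, ‖s ^ (α - 1) • W s x‖ ≤ C₀ * (s ^ β * ‖x‖) := by
    intro s hs x
    rcases hs.1.eq_or_lt with h0 | h0
    · rw [← h0, Real.zero_rpow (by linarith), Real.zero_rpow hβneg.ne]
      simp
    · rw [norm_smul, Real.norm_of_nonneg (Real.rpow_nonneg h0.le _)]
      have h1 := (W s).le_of_opNorm_le (hC₀ s ⟨h0, hs.2⟩) x
      calc s ^ (α - 1) * ‖W s x‖ ≤ s ^ (α - 1) * (C₀ * s ^ (-μ) * ‖x‖) :=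
            mul_le_mul_of_nonneg_left h1 (Real.rpow_nonneg h0.le _)
        _ = C₀ * ((s ^ (α - 1) * s ^ (-μ)) * ‖x‖) := by ring
        _ = C₀ * (s ^ β * ‖x‖) := by rw [← Real.rpow_add h0, ← sub_eq_add_neg]
  have hK2 : ∀ s h : ℝ, 0 < s → 0 ≤ h → s + h ≤ T → ∀ x : E,
      ‖(s + h) ^ (α - 1) • W (s + h) x - s ^ (α - 1) • W s x‖ ≤
        ((C₀ + C₁) * h) * (s ^ (β - 1) * ‖x‖) := by
    intro s h hs hh hT' x
    have e : (s + h) ^ (α - 1) • W (s + h) x - s ^ (α - 1) • W s x =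
        (s + h) ^ (α - 1) • (W (s + h) - W s) x +
          ((s + h) ^ (α - 1) - s ^ (α - 1)) • W s x := by
      simp only [sub_apply, smul_sub, sub_smul]
      abel
    have b1 := hW1 s (s + h) hs (by linarith) hT'
    rw [add_sub_cancel_left, Real.rpow_one] at b1
    have b2 := (W (s + h) - W s).le_of_opNorm_le b1 x
    have b3 := (W s).le_of_opNorm_le (hC₀ s ⟨hs, by linarith⟩) x
    have b4 : (s + h) ^ (α - 1) ≤ s ^ (α - 1) :=
      Real.rpow_le_rpow_of_nonpos hs (by linarith) (by linarith)
    have b5 := aux_rpow hαpos hα1 hs hh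
    have e1 : s ^ (α - 1) * s ^ (-(μ + 1)) = s ^ (β - 1) := by
      rw [← Real.rpow_add hs]; congr 1; rw [hβ]; ring
    have e2 : s ^ (α - 2) * s ^ (-μ) = s ^ (β - 1) := by
      rw [← Real.rpow_add hs]; congr 1; rw [hβ]; ring
    rw [e]
    refine (norm_add_le _ _).trans ?_
    rw [norm_smul, norm_smul, Real.norm_of_nonneg (Real.rpow_nonneg (by linarith) _),
      Real.norm_eq_abs]
    calc _ ≤ s ^ (α - 1) * (C₁ * h * s ^ (-(μ + 1)) * ‖x‖) +
          (h * s ^ (α - 2)) * (C₀ * s ^ (-μ) * ‖x‖) := by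
            gcongr
      _ = C₁ * h * (s ^ (α - 1) * s ^ (-(μ + 1))) * ‖x‖ +
          C₀ * h * (s ^ (α - 2) * s ^ (-μ)) * ‖x‖ := by ring
      _ = _ := by rw [e1, e2]; ring
  set D₁ : ℝ := (1 / (β * q + 1)) ^ (1 / q) with hD₁
  set D₂ : ℝ := (1 / (-((β - 1) * q + 1))) ^ (1 / q) with hD₂
  have hD₁0 : 0 ≤ D₁ := Real.rpow_nonneg (by positivity) _
  have hD₂0 : 0 ≤ D₂ := Real.rpow_nonneg (one_div_nonneg.2 (by linarith)) _
  refine ⟨C₀ * D₁ * 2 ^ δ + C₀ * D₁ + (C₀ + C₁) * D₂, by positivity, ?_⟩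
  intro f hf hfp
  set N : ℝ := (∫ r in Ioc (0 : ℝ) T, ‖f r‖ ^ p) ^ (1 / p) with hN
  have hN0 : 0 ≤ N := Real.rpow_nonneg (integral_nonneg fun r => by positivity) _
  have hNA : ∀ A : Set ℝ, A ⊆ Ioc 0 T → (∫ r in A, ‖f r‖ ^ p) ^ (1 / p) ≤ N := by
    intro A hA
    refine Real.rpow_le_rpow (integral_nonneg fun r => by positivity) ?_ hip.le
    exact setIntegral_mono_set hfp (ae_of_all _ fun r => by positivity)
      (Filter.Eventually.of_forall hA)
  -- measurability
  have hmeas : ∀ t ∈ Icc (0 : ℝ) T, AEStronglyMeasurable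
      (fun r => (t - r) ^ (α - 1) • W (t - r) (f r)) (volume.restrict (Ioc 0 t)) := by
    intro t ht
    have m1 : AEStronglyMeasurable (fun r => W (t - r)) (volume.restrict (Ioc 0 t)) := by
      rw [← restrict_Ioo_eq_restrict_Ioc]
      refine ContinuousOn.aestronglyMeasurable ?_ measurableSet_Ioo
      refine hWc.comp (by fun_prop) ?_
      intro r hr
      exact ⟨by linarith [hr.2], by linarith [hr.1, ht.2]⟩
    have m2 : AEStronglyMeasurable f (volume.restrict (Ioc 0 t)) :=
      hf.mono_measure (Measure.restrict_mono (Ioc_subset_Ioc_right ht.2) le_rfl)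
    have m3 : AEStronglyMeasurable (fun r : ℝ => (t - r) ^ (α - 1))
        (volume.restrict (Ioc 0 t)) := by
      apply Measurable.aestronglyMeasurable
      fun_prop
    have m4 : AEStronglyMeasurable (fun r => W (t - r) (f r)) (volume.restrict (Ioc 0 t)) :=
      (ContinuousLinearMap.id ℝ (E →L[ℝ] E₁)).aestronglyMeasurable_comp₂ m1 m2
    exact m3.smul m4
  -- piece near the diagonal
  have P1 : ∀ t ∈ Icc (0 : ℝ) T, ∀ m ∈ Icc (0 : ℝ) t,
      IntegrableOn (fun r => (t - r) ^ (α - 1) • W (t - r) (f r)) (Ioc m t) ∧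
      ‖∫ r in Ioc m t, (t - r) ^ (α - 1) • W (t - r) (f r)‖ ≤
        C₀ * D₁ * N * (t - m) ^ δ := by
    intro t ht m hm
    have hsub : Ioc m t ⊆ Ioc 0 T := Ioc_subset_Ioc hm.1 ht.2
    obtain ⟨k1, k2⟩ := aux_ker1 (β := β) (q := q) hm.2 hβq0
    obtain ⟨i1, i2⟩ := aux_holder hpq measurableSet_Ioc
      (hf.mono_measure (Measure.restrict_mono hsub le_rfl)) (hfp.mono_set hsub)
      (g := fun r => (t - r) ^ β) (by fun_prop)
      (fun r hr => Real.rpow_nonneg (by linarith [hr.2]) _) k1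
      ((hmeas t ht).mono_measure (Measure.restrict_mono (Ioc_subset_Ioc_left hm.1) le_rfl))
      hC₀0 (fun r hr => hK1 (t - r) ⟨by linarith [hr.2], by linarith [hr.1, hm.1, ht.2]⟩ (f r))
    refine ⟨i1, i2.trans ?_⟩
    have htm : 0 ≤ t - m := by linarith [hm.2]
    have e : ((t - m) ^ (β * q + 1) / (β * q + 1)) ^ (1 / q) = D₁ * (t - m) ^ δ := by
      rw [div_eq_mul_one_div, Real.mul_rpow (Real.rpow_nonneg htm _) (by positivity),
        ← Real.rpow_mul htm, hβq, mul_assoc, mul_comm q, hiq, mul_one, hD₁, hβq, mul_comm]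
    rw [k2, e]
    calc _ ≤ C₀ * (D₁ * (t - m) ^ δ * N) := by
          gcongr
          exact hNA _ hsub
      _ = _ := by ring
  -- ordered Hölder bound
  have main : ∀ t₁ t₂ : ℝ, 0 ≤ t₁ → t₁ < t₂ → t₂ ≤ T →
      ‖(∫ r in Ioc (0 : ℝ) t₂, (t₂ - r) ^ (α - 1) • W (t₂ - r) (f r)) -
              ∫ r in Ioc (0 : ℝ) t₁, (t₁ - r) ^ (α - 1) • W (t₁ - r) (f r)‖ ≤
        (C₀ * D₁ * 2 ^ δ + C₀ * D₁ + (C₀ + C₁) * D₂) * N * (t₂ - t₁) ^ δ := by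
    intro t₁ t₂ h1 h12 h2
    set h : ℝ := t₂ - t₁ with hh
    have hh0 : 0 < h := by rw [hh]; linarith
    set m : ℝ := max 0 (t₁ - h) with hm
    have hm0 : 0 ≤ m := le_max_left _ _
    have hm1 : m ≤ t₁ := max_le h1 (by linarith)
    have hm2 : t₁ - h ≤ m := le_max_right _ _
    have ht1 : t₁ ∈ Icc (0 : ℝ) T := ⟨h1, by linarith⟩
    have ht2 : t₂ ∈ Icc (0 : ℝ) T := ⟨by linarith, h2⟩
    obtain ⟨a1, a2⟩ := P1 t₁ ht1 m ⟨hm0, hm1⟩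
    obtain ⟨b1, b2⟩ := P1 t₂ ht2 m ⟨hm0, by linarith⟩
    have a3 := (P1 t₁ ht1 0 ⟨le_rfl, h1⟩).1
    have b3 := (P1 t₂ ht2 0 ⟨le_rfl, ht2.1⟩).1
    have a4 := a3.mono_set (Ioc_subset_Ioc_right hm1)
    have b4 := b3.mono_set (Ioc_subset_Ioc_right (hm1.trans h12.le))
    have dj : ∀ t, Disjoint (Ioc 0 m) (Ioc m t) := fun t => Ioc_disjoint_Ioc_of_le le_rfl
    rw [← Ioc_union_Ioc_eq_Ioc hm0 hm1, setIntegral_union (dj _) measurableSet_Ioc a4 a1,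
      ← Ioc_union_Ioc_eq_Ioc hm0 (hm1.trans h12.le),
      setIntegral_union (dj _) measurableSet_Ioc b4 b1]
    have c1 : ‖(∫ r in Ioc 0 m, (t₂ - r) ^ (α - 1) • W (t₂ - r) (f r)) -
        ∫ r in Ioc 0 m, (t₁ - r) ^ (α - 1) • W (t₁ - r) (f r)‖ ≤
          (C₀ + C₁) * D₂ * N * h ^ δ := by
      rcases le_total (t₁ - h) 0 with hc | hc
      · have : m = 0 := max_eq_left hc
        rw [this]
        simp only [Ioc_self, Measure.restrict_empty, integral_zero_measure, sub_self, norm_zero]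
        positivity
      · have hmm : m = t₁ - h := max_eq_right hc
        have hsub : Ioc 0 m ⊆ Ioc 0 T := Ioc_subset_Ioc_right (by linarith)
        rw [← integral_sub b4 a4]
        obtain ⟨k1, k2⟩ := aux_ker2 (γ := β - 1) (q := q) (m := 0) (t := t₁) hh0 hc hγq0
        rw [← hmm] at k1 k2
        obtain ⟨i1, i2⟩ := aux_holder hpq measurableSet_Ioc
          (hf.mono_measure (Measure.restrict_mono hsub le_rfl)) (hfp.mono_set hsub)
          (g := fun r => (t₁ - r) ^ (β - 1)) (by fun_prop)
          (fun r hr => Real.rpow_nonneg (by linarith [hr.2]) _) k1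
          (b4.sub a4).aestronglyMeasurable
          (c := (C₀ + C₁) * h) (by positivity) (fun r hr => by
            have := hK2 (t₁ - r) h (by linarith [hr.2]) hh0.le (by linarith [hr.1]) (f r)
            rw [show t₁ - r + h = t₂ - r by rw [hh]; ring] at this
            exact this)
        refine i2.trans ?_
        have hneg : 0 < -((β - 1) * q + 1) := by linarith
        have e : (h ^ ((β - 1) * q + 1) / (-((β - 1) * q + 1))) ^ (1 / q) =
            D₂ * h ^ (δ - 1) := by
          rw [div_eq_mul_one_div, Real.mul_rpow (Real.rpow_nonneg hh0.le _) (by positivity),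
            ← hD₂, ← Real.rpow_mul hh0.le, hγq, mul_assoc, mul_comm q, hiq, mul_one, mul_comm]
        have e' : (∫ r in Ioc 0 m, ((t₁ - r) ^ (β - 1)) ^ q) ^ (1 / q) ≤ D₂ * h ^ (δ - 1) := by
          rw [← e]
          refine Real.rpow_le_rpow ?_ k2 (by positivity)
          refine setIntegral_nonneg measurableSet_Ioc fun r hr => ?_
          exact Real.rpow_nonneg (Real.rpow_nonneg (by linarith [hr.2]) _) _
        calc _ ≤ (C₀ + C₁) * h * ((D₂ * h ^ (δ - 1)) * N) := by
              gcongr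
              exact hNA _ hsub
          _ = (C₀ + C₁) * D₂ * N * (h ^ (δ - 1) * h) := by ring
          _ = _ := by rw [← Real.rpow_add_one hh0.ne', sub_add_cancel]
    have a5 : (t₁ - m) ^ δ ≤ h ^ δ :=
      Real.rpow_le_rpow (by linarith) (by linarith) hδ0.le
    have b5 : (t₂ - m) ^ δ ≤ 2 ^ δ * h ^ δ := by
      rw [← Real.mul_rpow zero_le_two hh0.le]
      exact Real.rpow_le_rpow (by linarith) (by linarith) hδ0.le
    have a6 := a2.trans (mul_le_mul_of_nonneg_left a5 (by positivity))
    have b6 := b2.trans (mul_le_mul_of_nonneg_left b5 (by positivity))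
    rw [add_sub_add_comm]
    refine (norm_add_le _ _).trans ?_
    have := norm_sub_le (∫ r in Ioc m t₂, (t₂ - r) ^ (α - 1) • W (t₂ - r) (f r))
      (∫ r in Ioc m t₁, (t₁ - r) ^ (α - 1) • W (t₁ - r) (f r))
    calc _ ≤ (C₀ + C₁) * D₂ * N * h ^ δ +
          (C₀ * D₁ * N * (2 ^ δ * h ^ δ) + C₀ * D₁ * N * h ^ δ) :=
            add_le_add c1 (this.trans (add_le_add b6 a6))
      _ = _ := by ring
  refine ⟨fun t ht => (P1 t ht 0 ⟨le_rfl, ht.1⟩).1, by simp, ?_⟩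
  intro t₁ ht₁ t₂ ht₂
  rcases lt_trichotomy t₁ t₂ with hlt | heq | hlt
  · rw [abs_of_pos (sub_pos.2 hlt)]
    exact main t₁ t₂ ht₁.1 hlt ht₂.2
  · subst heq
    rw [sub_self, norm_zero]
    positivity
  · rw [norm_sub_rev, abs_sub_comm, abs_of_pos (sub_pos.2 hlt)]
    exact main t₂ t₁ ht₂.1 hlt ht₁.2
end

section
/- Let O ⊆ ℝ^d be a bounded open set, q ∈ [1,∞), θ ∈ (0,1) and ε ∈ (θ, 1]. Let g : ℝ → ℝ be Lipschitz continuous with Lipschitz constant L_g and g(0) = 0, let (λ_n)_{n≥1} be nonnegative reals and (h_n)_{n≥1} bounded ε-Hölder continuous functions on O with C_Q := Σ_{n≥1} √λ_n ‖h_n‖_{C^ε(O)} < ∞. Then there is a constant C depending only on d, q, θ, ε and O such that for every measurable u : O → ℝ with ‖u‖_{W^{θ,q}(O)} < ∞: Σ_{n≥1} √λ_n ‖(g∘u) · h_n‖_{W^{θ,q}(O)} ≤ C L_g C_Q ‖u‖_{W^{θ,q}(O)}. -/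
open MeasureTheory Set Real

/-- The Sobolev–Slobodeckij norm
`‖u‖_{W^{θ,q}(O)} = (‖u‖_{L^q(O)}^q + ∫_O ∫_O |u(ξ)-u(η)|^q / |ξ-η|^{d+θq} dξ dη)^{1/q}`. -/
noncomputable def slobNorm (d : ℕ) (O : Set (EuclideanSpace ℝ (Fin d))) (q θ : ℝ)
    (u : EuclideanSpace ℝ (Fin d) → ℝ) : ℝ :=
  ((∫ ξ in O, |u ξ| ^ q) +
      ∫ η in O, ∫ ξ in O, |u ξ - u η| ^ q / ‖ξ - η‖ ^ ((d : ℝ) + θ * q)) ^ (1 / q)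

/-- The Hölder norm `‖h‖_{C^ε(O)} = sup_{ξ∈O} |h(ξ)| + sup_{ξ≠η∈O} |h(ξ)-h(η)|/|ξ-η|^ε`. -/
noncomputable def holderNorm (d : ℕ) (O : Set (EuclideanSpace ℝ (Fin d))) (ε : ℝ)
    (h : EuclideanSpace ℝ (Fin d) → ℝ) : ℝ :=
  sSup ((fun ξ => |h ξ|) '' O) +
    sSup ((fun p : EuclideanSpace ℝ (Fin d) × EuclideanSpace ℝ (Fin d) =>
        |h p.1 - h p.2| / ‖p.1 - p.2‖ ^ ε) '' {p | p.1 ∈ O ∧ p.2 ∈ O ∧ p.1 ≠ p.2})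

lemma aux_kernel (d : ℕ) (s R : ℝ) (hs : 0 < s) :
    Integrable ((Metric.ball (0 : EuclideanSpace ℝ (Fin d)) R).indicator
      (fun z => ‖z‖ ^ (s - (d : ℝ)))) := by
  rcases Nat.eq_zero_or_pos d with rfl | hd
  · have : (fun z : EuclideanSpace ℝ (Fin 0) => ‖z‖ ^ (s - ((0 : ℕ) : ℝ))) =
        fun _ => (0 : ℝ) := by
      funext z
      rw [Subsingleton.elim z 0]
      simp [Real.zero_rpow hs.ne']
    rw [this]
    simp
  · have : Nonempty (Fin d) := ⟨⟨0, hd⟩⟩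
    have key := (integrable_fun_norm_addHaar (volume : Measure (EuclideanSpace ℝ (Fin d)))
      (f := (Iio R).indicator (fun t : ℝ => t ^ (s - (d : ℝ))))).2 ?_
    · refine key.congr (Filter.Eventually.of_forall fun z => ?_)
      simp [indicator]
    · rw [finrank_euclideanSpace_fin]
      have h1 : IntegrableOn (fun t : ℝ => t ^ (s - 1)) (Ioo 0 R) := by
        rcases le_or_gt R 0 with hR | hR
        · simp [Ioo_eq_empty_of_le hR]
        · exact (intervalIntegral.integrableOn_Ioo_rpow_iff hR).2 (by linarith)
      have h2 : IntegrableOn ((Iio R).indicator (fun t : ℝ => t ^ (s - 1))) (Ioi 0) := by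
        rw [IntegrableOn, integrable_indicator_iff measurableSet_Iio, IntegrableOn,
          Measure.restrict_restrict measurableSet_Iio, inter_comm, Ioi_inter_Iio]
        exact h1
      refine h2.congr_fun (fun t ht => ?_) measurableSet_Ioi
      have ht : 0 < t := ht
      by_cases h : t ∈ Iio R
      · simp only [indicator_of_mem h, smul_eq_mul]
        rw [← Real.rpow_natCast, ← Real.rpow_add ht]
        congr 1
        rw [Nat.cast_sub hd]; push_cast; ring
      · simp [indicator_of_notMem h]

lemma holder_bounds (d : ℕ) (O : Set (EuclideanSpace ℝ (Fin d))) (ε : ℝ)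
    (h : EuclideanSpace ℝ (Fin d) → ℝ) (hB : ∃ B : ℝ, ∀ ξ ∈ O, |h ξ| ≤ B)
    (hH : ∃ H : ℝ, ∀ ξ ∈ O, ∀ η ∈ O, |h ξ - h η| ≤ H * ‖ξ - η‖ ^ ε) :
    0 ≤ holderNorm d O ε h ∧ (∀ ξ ∈ O, |h ξ| ≤ holderNorm d O ε h) ∧
    (∀ ξ ∈ O, ∀ η ∈ O, ξ ≠ η → |h ξ - h η| ≤ holderNorm d O ε h * ‖ξ - η‖ ^ ε) := by
  obtain ⟨B, hB⟩ := hB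
  obtain ⟨H, hH⟩ := hH
  unfold holderNorm
  have n1 : 0 ≤ sSup ((fun ξ => |h ξ|) '' O) := by
    apply Real.sSup_nonneg
    rintro _ ⟨x, _, rfl⟩
    exact abs_nonneg _
  have n2 : 0 ≤ sSup ((fun p : EuclideanSpace ℝ (Fin d) × EuclideanSpace ℝ (Fin d) =>
        |h p.1 - h p.2| / ‖p.1 - p.2‖ ^ ε) '' {p | p.1 ∈ O ∧ p.2 ∈ O ∧ p.1 ≠ p.2}) := by
    apply Real.sSup_nonneg
    rintro _ ⟨x, _, rfl⟩
    positivity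
  refine ⟨by positivity, fun ξ hξ => ?_, fun ξ hξ η hη hne => ?_⟩
  · have : |h ξ| ≤ sSup ((fun ξ => |h ξ|) '' O) := by
      apply le_csSup
      · refine ⟨B, ?_⟩
        rintro _ ⟨x, hx, rfl⟩
        exact hB x hx
      · exact ⟨ξ, hξ, rfl⟩
    linarith
  · have hpos : 0 < ‖ξ - η‖ ^ ε := Real.rpow_pos_of_pos (norm_pos_iff.2 (sub_ne_zero.2 hne)) _
    rw [← div_le_iff₀ hpos]
    have : |h ξ - h η| / ‖ξ - η‖ ^ ε ≤
      sSup ((fun p : EuclideanSpace ℝ (Fin d) × EuclideanSpace ℝ (Fin d) =>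
        |h p.1 - h p.2| / ‖p.1 - p.2‖ ^ ε) '' {p | p.1 ∈ O ∧ p.2 ∈ O ∧ p.1 ≠ p.2}) := by
      apply le_csSup
      · refine ⟨H, ?_⟩
        rintro _ ⟨⟨x, y⟩, ⟨hx, hy, hxy⟩, rfl⟩
        have hpos : 0 < ‖x - y‖ ^ ε := Real.rpow_pos_of_pos (norm_pos_iff.2 (sub_ne_zero.2 hxy)) _
        exact (div_le_iff₀ hpos).2 (hH x hx y hy)
      · exact ⟨(ξ, η), ⟨hξ, hη, hne⟩, rfl⟩
    linarith

lemma add_rpow_le_two (a b q : ℝ) (ha : 0 ≤ a) (hb : 0 ≤ b) (hq : 0 ≤ q) :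
    (a + b) ^ q ≤ 2 ^ q * (a ^ q + b ^ q) := by
  have pa : 0 ≤ a ^ q := Real.rpow_nonneg ha q
  have pb : 0 ≤ b ^ q := Real.rpow_nonneg hb q
  have p2 : (0 : ℝ) ≤ 2 ^ q := by positivity
  rcases le_total a b with h | h
  · calc (a + b) ^ q ≤ (2 * b) ^ q := Real.rpow_le_rpow (by positivity) (by linarith) hq
      _ = 2 ^ q * b ^ q := Real.mul_rpow (by norm_num) hb
      _ ≤ _ := by gcongr; linarith
  · calc (a + b) ^ q ≤ (2 * a) ^ q := Real.rpow_le_rpow (by positivity) (by linarith) hq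
      _ = 2 ^ q * a ^ q := Real.mul_rpow (by norm_num) ha
      _ ≤ _ := by gcongr; linarith

lemma slob_mul_le (d : ℕ) (O : Set (EuclideanSpace ℝ (Fin d)))
    (hOo : IsOpen O) (q θ ε R N Lg : ℝ) (hq : 1 ≤ q) (hε : θ < ε)
    (hR : ∀ ξ ∈ O, ∀ η ∈ O, ‖ξ - η‖ < R) (hN : 0 ≤ N) (hL : 0 ≤ Lg)
    (g : ℝ → ℝ) (hg : ∀ a b : ℝ, |g a - g b| ≤ Lg * |a - b|) (hg0 : g 0 = 0)
    (h : EuclideanSpace ℝ (Fin d) → ℝ)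
    (h1 : ∀ ξ ∈ O, |h ξ| ≤ N)
    (h2 : ∀ ξ ∈ O, ∀ η ∈ O, ξ ≠ η → |h ξ - h η| ≤ N * ‖ξ - η‖ ^ ε)
    (u : EuclideanSpace ℝ (Fin d) → ℝ)
    (hu1 : IntegrableOn (fun ξ => |u ξ| ^ q) O)
    (hu2 : IntegrableOn
              (fun p : EuclideanSpace ℝ (Fin d) × EuclideanSpace ℝ (Fin d) =>
                |u p.1 - u p.2| ^ q / ‖p.1 - p.2‖ ^ ((d : ℝ) + θ * q)) (O ×ˢ O)) :
    slobNorm d O q θ (fun ξ => g (u ξ) * h ξ) ≤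
      (1 + 2 ^ q + 2 ^ q * ∫ z, (Metric.ball (0 : EuclideanSpace ℝ (Fin d)) R).indicator
      (fun z => ‖z‖ ^ ((ε - θ) * q - (d : ℝ))) z) ^ (1 / q) * Lg * N * slobNorm d O q θ u := by
  have hq0 : 0 < q := by linarith
  have hm : MeasurableSet O := hOo.measurableSet
  set k := (Metric.ball (0 : EuclideanSpace ℝ (Fin d)) R).indicator
      (fun z => ‖z‖ ^ ((ε - θ) * q - (d : ℝ))) with hk
  have hki : Integrable k := aux_kernel d _ R (mul_pos (by linarith) hq0)
  have hk0 : ∀ z, 0 ≤ k z := fun z => indicator_nonneg (fun z _ => by positivity) z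
  set M := ∫ z, k z with hM
  have hM0 : 0 ≤ M := integral_nonneg hk0
  have hgu : ∀ x, |g (u x)| ≤ Lg * |u x| := fun x => by
    have := hg (u x) 0
    simpa [hg0] using this
  set P := (Lg * N) ^ q with hP
  have hP0 : 0 ≤ P := Real.rpow_nonneg (by positivity) _
  have hD0 : (0 : ℝ) ≤ 2 ^ q := by positivity
  set K : EuclideanSpace ℝ (Fin d) → EuclideanSpace ℝ (Fin d) → ℝ := fun η ξ =>
    |u ξ - u η| ^ q / ‖ξ - η‖ ^ ((d : ℝ) + θ * q) with hK
  have hK0 : ∀ η ξ, 0 ≤ K η ξ := fun η ξ => by simp only [hK]; positivity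
  -- the zero order term
  have e1 : ∫ ξ in O, |g (u ξ) * h ξ| ^ q ≤ P * ∫ ξ in O, |u ξ| ^ q := by
    rw [← integral_const_mul]
    refine integral_mono_of_nonneg (Filter.Eventually.of_forall fun x => by positivity)
      (hu1.const_mul P) ?_
    refine ae_restrict_of_forall_mem hm fun x hx => ?_
    have : |g (u x) * h x| ≤ (Lg * N) * |u x| := by
      rw [abs_mul]
      calc _ ≤ (Lg * |u x|) * N := mul_le_mul (hgu x) (h1 x hx) (abs_nonneg _) (by positivity)
        _ = _ := by ring
    calc |g (u x) * h x| ^ q ≤ ((Lg * N) * |u x|) ^ q :=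
          Real.rpow_le_rpow (abs_nonneg _) this hq0.le
      _ = P * |u x| ^ q := Real.mul_rpow (by positivity) (abs_nonneg _)
  -- pointwise bound
  have pt : ∀ η ∈ O, ∀ ξ ∈ O,
      |g (u ξ) * h ξ - g (u η) * h η| ^ q / ‖ξ - η‖ ^ ((d : ℝ) + θ * q) ≤
        2 ^ q * P * (K η ξ + |u η| ^ q * k (ξ - η)) := by
    intro η hη ξ hξ
    by_cases hne : ξ = η
    · subst hne
      have z : |g (u ξ) * h ξ - g (u ξ) * h ξ| ^ q = 0 := by
        simp [Real.zero_rpow hq0.ne']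
      rw [z, zero_div]
      have := hK0 ξ ξ
      have := hk0 (ξ - ξ)
      positivity
    · have hr : 0 < ‖ξ - η‖ := norm_pos_iff.2 (sub_ne_zero.2 hne)
      have hkv : k (ξ - η) = ‖ξ - η‖ ^ ((ε - θ) * q - (d : ℝ)) := by
        rw [hk, indicator_of_mem]
        rw [mem_ball_zero_iff]
        exact hR ξ hξ η hη
      have hrp : 0 < ‖ξ - η‖ ^ ((d : ℝ) + θ * q) := Real.rpow_pos_of_pos hr _
      have b1 : |g (u ξ) * h ξ - g (u η) * h η| ≤
          (Lg * N) * (|u ξ - u η| + |u η| * ‖ξ - η‖ ^ ε) := by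
        have : g (u ξ) * h ξ - g (u η) * h η =
          (g (u ξ) - g (u η)) * h ξ + g (u η) * (h ξ - h η) := by ring
        rw [this]
        refine (abs_add_le _ _).trans ?_
        rw [abs_mul, abs_mul]
        have c1 : |g (u ξ) - g (u η)| * |h ξ| ≤ (Lg * |u ξ - u η|) * N :=
          mul_le_mul (hg _ _) (h1 ξ hξ) (abs_nonneg _) (by positivity)
        have c2 : |g (u η)| * |h ξ - h η| ≤ (Lg * |u η|) * (N * ‖ξ - η‖ ^ ε) :=
          mul_le_mul (hgu _) (h2 ξ hξ η hη hne) (abs_nonneg _) (by positivity)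
        linarith
      have b2 : |g (u ξ) * h ξ - g (u η) * h η| ^ q ≤
          P * (2 ^ q * (|u ξ - u η| ^ q + |u η| ^ q * ‖ξ - η‖ ^ (ε * q))) := by
        calc _ ≤ ((Lg * N) * (|u ξ - u η| + |u η| * ‖ξ - η‖ ^ ε)) ^ q :=
              Real.rpow_le_rpow (abs_nonneg _) b1 hq0.le
          _ = P * (|u ξ - u η| + |u η| * ‖ξ - η‖ ^ ε) ^ q :=
              Real.mul_rpow (by positivity) (by positivity)
          _ ≤ P * (2 ^ q * (|u ξ - u η| ^ q + (|u η| * ‖ξ - η‖ ^ ε) ^ q)) := by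
              gcongr
              exact add_rpow_le_two _ _ _ (by positivity) (by positivity) hq0.le
          _ = _ := by
              rw [Real.mul_rpow (abs_nonneg _) (by positivity), ← Real.rpow_mul hr.le]
      calc _ ≤ P * (2 ^ q * (|u ξ - u η| ^ q + |u η| ^ q * ‖ξ - η‖ ^ (ε * q))) /
            ‖ξ - η‖ ^ ((d : ℝ) + θ * q) := by gcongr
        _ = 2 ^ q * P * (|u ξ - u η| ^ q / ‖ξ - η‖ ^ ((d : ℝ) + θ * q) + |u η| ^ q *
            (‖ξ - η‖ ^ (ε * q) / ‖ξ - η‖ ^ ((d : ℝ) + θ * q))) := by ring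
        _ = _ := by
            rw [← Real.rpow_sub hr, hkv]
            congr 4
            ring
  have hu2' : Integrable (fun p : EuclideanSpace ℝ (Fin d) × EuclideanSpace ℝ (Fin d) =>
      K p.2 p.1) ((volume.restrict O).prod (volume.restrict O)) := by
    rw [Measure.prod_restrict]
    exact hu2
  have hin := hu2'.prod_left_ae
  have hout := hu2'.integral_prod_right
  simp only at hin hout
  have e2 : ∫ η in O, ∫ ξ in O,
      |g (u ξ) * h ξ - g (u η) * h η| ^ q / ‖ξ - η‖ ^ ((d : ℝ) + θ * q) ≤
      2 ^ q * P * ((∫ η in O, ∫ ξ in O, K η ξ) + M * ∫ η in O, |u η| ^ q) := by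
    rw [← integral_const_mul M, ← integral_add hout (hu1.const_mul M), ← integral_const_mul]
    refine integral_mono_of_nonneg
      (Filter.Eventually.of_forall fun x => integral_nonneg fun y => by positivity)
      ((hout.add (hu1.const_mul M)).const_mul _) ?_
    filter_upwards [hin, ae_restrict_mem hm] with η hη hηO
    have hkη : Integrable (fun ξ => k (ξ - η)) := hki.comp_sub_right η
    calc _ ≤ ∫ ξ in O, 2 ^ q * P * (K η ξ + |u η| ^ q * k (ξ - η)) := by
          refine integral_mono_of_nonneg (Filter.Eventually.of_forall fun x => by positivity)
            ((hη.add (hkη.restrict.const_mul _)).const_mul _) ?_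
          exact ae_restrict_of_forall_mem hm fun ξ hξ => pt η hηO ξ hξ
      _ = 2 ^ q * P * ((∫ ξ in O, K η ξ) + |u η| ^ q * ∫ ξ in O, k (ξ - η)) := by
          rw [integral_const_mul, integral_add hη (hkη.restrict.const_mul _), integral_const_mul]
      _ ≤ 2 ^ q * P * ((∫ ξ in O, K η ξ) + |u η| ^ q * M) := by
          gcongr
          rw [hM, ← integral_sub_right_eq_self k η]
          exact setIntegral_le_integral hkη (Filter.Eventually.of_forall fun ξ => hk0 _)
      _ = _ := by ring
  unfold slobNorm
  set A := ∫ ξ in O, |u ξ| ^ q with hA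
  have hA0 : 0 ≤ A := integral_nonneg fun x => by positivity
  have hB0 : 0 ≤ ∫ η in O, ∫ ξ in O, K η ξ :=
    integral_nonneg fun x => integral_nonneg fun y => hK0 _ _
  change _ ≤ _ * Lg * N * (A + ∫ η in O, ∫ ξ in O, K η ξ) ^ (1 / q)
  set B := ∫ η in O, ∫ ξ in O, K η ξ with hB
  have hLN : Lg * N = P ^ (1 / q) := by
    rw [hP, ← Real.rpow_mul (by positivity), mul_one_div_cancel hq0.ne', Real.rpow_one]
  rw [mul_assoc _ Lg N, hLN, ← Real.mul_rpow (by positivity) hP0,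
    ← Real.mul_rpow (by positivity) (by positivity)]
  refine Real.rpow_le_rpow ?_ ?_ (by positivity)
  · exact add_nonneg (integral_nonneg fun x => by positivity)
      (integral_nonneg fun x => integral_nonneg fun y => by positivity)
  · refine (add_le_add e1 e2).trans ?_
    have t1 : 0 ≤ P * B := by positivity
    have t2 : 0 ≤ 2 ^ q * (P * A) := by positivity
    have t3 : 0 ≤ 2 ^ q * M * (P * B) := by positivity
    nlinarith [t1, t2, t3]

/-- Growth estimate in fractional-order spaces for the diffusion
coefficient `G(u)h_n = √λ_n g(u) h_n` of the stochastic heat equation: with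
`C_Q = Σ √λ_n ‖h_n‖_{C^ε(O)} < ∞`, `g` Lipschitz with `g(0) = 0`, there is
`C = C(d,q,θ,ε,O)` such that
`Σ √λ_n ‖(g∘u)·h_n‖_{W^{θ,q}(O)} ≤ C L_g C_Q ‖u‖_{W^{θ,q}(O)}`. -/
theorem stmt_12
    (d : ℕ) (O : Set (EuclideanSpace ℝ (Fin d)))
    (hOo : IsOpen O) (hOb : Bornology.IsBounded O)
    (q θ ε : ℝ) (hq : 1 ≤ q) (hθ : θ ∈ Ioo (0 : ℝ) 1) (hε : ε ∈ Ioc θ 1) :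
    ∃ C : ℝ, 0 ≤ C ∧
      ∀ (g : ℝ → ℝ) (Lg : ℝ), 0 ≤ Lg →
        (∀ a b : ℝ, |g a - g b| ≤ Lg * |a - b|) → g 0 = 0 →
        ∀ (lam : ℕ → ℝ), (∀ n, 0 ≤ lam n) →
        ∀ h : ℕ → EuclideanSpace ℝ (Fin d) → ℝ,
          -- each `h_n` is bounded and `ε`-Hölder continuous on `O`
          (∀ n, ∃ B : ℝ, ∀ ξ ∈ O, |h n ξ| ≤ B) →
          (∀ n, ∃ H : ℝ, ∀ ξ ∈ O, ∀ η ∈ O, |h n ξ - h n η| ≤ H * ‖ξ - η‖ ^ ε) →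
          -- `C_Q = Σ √λ_n ‖h_n‖_{C^ε(O)} < ∞`
          Summable (fun n => Real.sqrt (lam n) * holderNorm d O ε (h n)) →
          ∀ u : EuclideanSpace ℝ (Fin d) → ℝ,
            Measurable u →
            IntegrableOn (fun ξ => |u ξ| ^ q) O →
            IntegrableOn
              (fun p : EuclideanSpace ℝ (Fin d) × EuclideanSpace ℝ (Fin d) =>
                |u p.1 - u p.2| ^ q / ‖p.1 - p.2‖ ^ ((d : ℝ) + θ * q)) (O ×ˢ O) →
            ∑' n : ℕ, Real.sqrt (lam n) *
                slobNorm d O q θ (fun ξ => g (u ξ) * h n ξ) ≤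
              C * Lg * (∑' n : ℕ, Real.sqrt (lam n) * holderNorm d O ε (h n)) *
                slobNorm d O q θ u := by
  obtain ⟨R, hR⟩ := hOb.subset_ball (0 : EuclideanSpace ℝ (Fin d))
  have hR' : ∀ ξ ∈ O, ∀ η ∈ O, ‖ξ - η‖ < R + R := fun ξ hξ η hη => by
    have a := mem_ball_zero_iff.1 (hR hξ)
    have b := mem_ball_zero_iff.1 (hR hη)
    exact (norm_sub_le _ _).trans_lt (by linarith)
  refine ⟨(1 + 2 ^ q + 2 ^ q * ∫ z, (Metric.ball (0 : EuclideanSpace ℝ (Fin d))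
      (R + R)).indicator (fun z => ‖z‖ ^ ((ε - θ) * q - (d : ℝ))) z) ^ (1 / q), ?_, ?_⟩
  · have : 0 ≤ ∫ z, (Metric.ball (0 : EuclideanSpace ℝ (Fin d))
      (R + R)).indicator (fun z => ‖z‖ ^ ((ε - θ) * q - (d : ℝ))) z :=
      integral_nonneg fun z => indicator_nonneg (fun z _ => by positivity) z
    positivity
  intro g Lg hL hg hg0 lam _ h hB hH hs u _ hu1 hu2
  have hb := fun n => holder_bounds d O ε (h n) (hB n) (hH n)
  have key := fun n => slob_mul_le d O hOo q θ ε (R + R) (holderNorm d O ε (h n)) Lg hq hε.1 hR'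
    (hb n).1 hL g hg hg0 (h n) (hb n).2.1 (hb n).2.2 u hu1 hu2
  set C := (1 + 2 ^ q + 2 ^ q * ∫ z, (Metric.ball (0 : EuclideanSpace ℝ (Fin d))
      (R + R)).indicator (fun z => ‖z‖ ^ ((ε - θ) * q - (d : ℝ))) z) ^ (1 / q)
  have hsl : ∀ v, 0 ≤ slobNorm d O q θ v := fun v =>
    Real.rpow_nonneg (add_nonneg (integral_nonneg fun x => by positivity)
      (integral_nonneg fun x => integral_nonneg fun y => by positivity)) _
  have hle : ∀ n, Real.sqrt (lam n) * slobNorm d O q θ (fun ξ => g (u ξ) * h n ξ) ≤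
      C * Lg * (Real.sqrt (lam n) * holderNorm d O ε (h n)) * slobNorm d O q θ u := fun n => by
    calc _ ≤ Real.sqrt (lam n) * (C * Lg * holderNorm d O ε (h n) * slobNorm d O q θ u) :=
          mul_le_mul_of_nonneg_left (key n) (Real.sqrt_nonneg _)
      _ = _ := by ring
  have hsum := (hs.mul_left (C * Lg)).mul_right (slobNorm d O q θ u)
  rw [← tsum_mul_left, ← tsum_mul_right]
  exact Summable.tsum_le_tsum hle
    (Summable.of_nonneg_of_le (fun n => mul_nonneg (Real.sqrt_nonneg _) (hsl _)) hle hsum) hsum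
end
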